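/- Consider the simple random walk on ℤ conditioned on {τ_{{0,2n}} > t} (the conditioned walk on the ring graph with 2n sites). Let t = t(n), Δ = Δ(n) be sequences such that t, Δ and t − Δ each satisfy liminf_{n→∞} (·)/( n² ln n ) ≥ 4/π². Then there exist C > 0 and n₀ such that for all n ≥ n₀ and all integers x with 1 < x < n: P_x[ τ_n > Δ | τ_{{0,2n}} > t ] ≤ (1 + C Δ n^{−4}) · (8/π) cos( πx/(2n) ) · exp( −3π²Δ/(8n²) ). -/

import Mathlib

open MeasureTheory ProbabilityTheory Finset Filter
open scoped ENNReal Topology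

/-- One step transition probability of the simple random walk on `ℤ`. -/
noncomputable def srwStep (u v : ℤ) : ℝ≥0∞ :=
  if v = u + 1 ∨ v = u - 1 then (1 : ℝ≥0∞) / 2 else 0

/-- `P x` is the law of the simple random walk `S` on `ℤ` started at `x`:
for every finite path `γ` with `γ 0 = x`, the probability of following `γ`
during the first `t` steps is the product of the one-step transition
probabilities. -/
def IsSRW {Ω : Type*} [MeasurableSpace Ω] (P : ℤ → Measure Ω) (S : ℕ → Ω → ℤ) : Prop :=
  (∀ x, IsProbabilityMeasure (P x)) ∧ (∀ t, Measurable (S t)) ∧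
    ∀ (x : ℤ) (t : ℕ) (γ : ℕ → ℤ), γ 0 = x →
      P x {ω | ∀ s ≤ t, S s ω = γ s} = ∏ s ∈ Finset.range t, srwStep (γ s) (γ (s + 1))

/-- Lagrange's identity for sums of cosines, multiplied out. -/
theorem two_mul_sin_half_mul_sum_cos (h : ℝ) (K : ℕ) :
    2 * Real.sin (h / 2) * ∑ k ∈ range K, Real.cos (k * h)
      = Real.sin (K * h - h / 2) + Real.sin (h / 2) := by
  induction K with
  | zero => simp [Real.sin_neg]
  | succ K ih =>
    rw [sum_range_succ, mul_add, ih]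
    have e : ((K + 1 : ℕ) : ℝ) * h - h / 2 = K * h + h / 2 := by push_cast; ring
    rw [e, Real.sin_add, Real.sin_sub]
    ring

theorem sum_cos_int_mul_pi_div {N : ℕ} (j : ℤ) (h0 : j ≠ 0) (h1 : |j| < 2 * N) :
    ∑ k ∈ range N, Real.cos (k * (Real.pi * j / N)) = (1 - Real.cos (Real.pi * j)) / 2 := by
  have hN : (0 : ℝ) < N := by
    rcases Nat.eq_zero_or_pos N with rfl | h
    · simp at h1
      have := abs_nonneg j
      omega
    · exact_mod_cast h
  have hs : Real.sin (Real.pi * j / N / 2) ≠ 0 := by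
    rw [Ne, Real.sin_eq_zero_iff]
    rintro ⟨i, hi⟩
    have hi' : (j : ℝ) = i * (2 * N) := by
      have := Real.pi_ne_zero
      field_simp at hi
      linarith
    have hj : j = i * (2 * N) := by exact_mod_cast hi'
    rcases eq_or_ne i 0 with rfl | hi0
    · simp at hj; exact h0 hj
    · have : 1 ≤ |i| := Int.one_le_abs hi0
      rw [hj, abs_mul, abs_of_nonneg (by positivity : (0 : ℤ) ≤ 2 * N)] at h1
      have : (0 : ℤ) ≤ 2 * N := by positivity
      nlinarith
  have key := two_mul_sin_half_mul_sum_cos (Real.pi * j / N) N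
  have e : (N : ℝ) * (Real.pi * j / N) - Real.pi * j / N / 2
      = j * Real.pi - Real.pi * j / N / 2 := by field_simp
  rw [e, Real.sin_sub, Real.sin_int_mul_pi, mul_comm (j : ℝ) Real.pi] at key
  apply mul_left_cancel₀ hs
  linear_combination key / 2

/-- Orthogonality of the discrete sine functions. -/
theorem sum_sin_mul_sin {N : ℕ} (x y : ℤ) (hx : 0 < x) (hxN : x < N) (hy : 0 < y) (hyN : y < N) :
    ∑ k ∈ Ioo 0 N, Real.sin (Real.pi * k / N * x) * Real.sin (Real.pi * k / N * y)
      = if x = y then (N : ℝ) / 2 else 0 := by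
  have hN : 0 < N := by omega
  have e1 : ∑ k ∈ Ioo 0 N, Real.sin (Real.pi * k / N * x) * Real.sin (Real.pi * k / N * y)
      = ∑ k ∈ range N, Real.sin (Real.pi * k / N * x) * Real.sin (Real.pi * k / N * y) := by
    apply sum_subset
    · intro k; simp
    · intro k hk hk'
      have : k = 0 := by simp at hk hk'; omega
      simp [this]
  have e2 : ∀ k : ℕ, Real.sin (Real.pi * k / N * x) * Real.sin (Real.pi * k / N * y)
      = (Real.cos (k * (Real.pi * (x - y : ℤ) / N))
          - Real.cos (k * (Real.pi * (x + y : ℤ) / N))) / 2 := by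
    intro k
    have a1 : (k : ℝ) * (Real.pi * (x - y : ℤ) / N)
        = Real.pi * k / N * x - Real.pi * k / N * y := by push_cast; ring
    have a2 : (k : ℝ) * (Real.pi * (x + y : ℤ) / N)
        = Real.pi * k / N * x + Real.pi * k / N * y := by push_cast; ring
    rw [a1, a2, Real.cos_sub, Real.cos_add]
    ring
  rw [e1, sum_congr rfl fun k _ => e2 k, ← sum_div, sum_sub_distrib,
    sum_cos_int_mul_pi_div (x + y) (by omega) (by rw [abs_lt]; constructor <;> omega)]
  split_ifs with h
  · subst h
    have : Real.cos (Real.pi * ((x + x : ℤ) : ℝ)) = 1 := by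
      rw [← Real.cos_int_mul_two_pi x]; congr 1; push_cast; ring
    rw [this]
    simp
  · rw [sum_cos_int_mul_pi_div (x - y) (by omega) (by rw [abs_lt]; constructor <;> omega)]
    have : Real.cos (Real.pi * ((x + y : ℤ) : ℝ)) = Real.cos (Real.pi * ((x - y : ℤ) : ℝ)) := by
      rw [← Real.cos_add_int_mul_two_pi _ (-y)]; congr 1; push_cast; ring
    rw [this]; ring

/-- The spectral formula for the `m`-step transition function of the simple random walk killed
on leaving `{1, …, N - 1}`. -/
noncomputable def sineKernel (N m : ℕ) (x y : ℝ) : ℝ :=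
  2 / N * ∑ k ∈ Ioo 0 N, Real.cos (Real.pi * k / N) ^ m
    * (Real.sin (Real.pi * k / N * x) * Real.sin (Real.pi * k / N * y))

theorem sineKernel_zero {N : ℕ} (x y : ℤ) (hx : 0 < x) (hxN : x < N) (hy : 0 < y) (hyN : y < N) :
    sineKernel N 0 x y = if x = y then 1 else 0 := by
  have hN : (N : ℝ) ≠ 0 := by
    have : N ≠ 0 := by omega
    exact_mod_cast this
  simp only [sineKernel, pow_zero, one_mul]
  rw [sum_sin_mul_sin x y hx hxN hy hyN]
  split_ifs
  · field_simp
  · simp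

theorem sineKernel_succ (N m : ℕ) (x y : ℝ) :
    sineKernel N (m + 1) x y = (sineKernel N m x (y - 1) + sineKernel N m x (y + 1)) / 2 := by
  unfold sineKernel
  rw [← mul_add, ← sum_add_distrib, mul_div_assoc, sum_div]
  congr 1
  apply sum_congr rfl
  intro k _
  rw [mul_sub, mul_add, mul_one, Real.sin_sub, Real.sin_add]
  ring

theorem sineKernel_right_zero (N m : ℕ) (x : ℝ) : sineKernel N m x 0 = 0 := by
  simp [sineKernel]

theorem sineKernel_right_self (N m : ℕ) (x : ℝ) : sineKernel N m x N = 0 := by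
  rcases eq_or_ne N 0 with rfl | hN
  · simp [sineKernel]
  have hN' : (N : ℝ) ≠ 0 := by exact_mod_cast hN
  unfold sineKernel
  rw [sum_eq_zero, mul_zero]
  intro k _
  have : Real.pi * k / N * N = k * Real.pi := by field_simp
  rw [this, Real.sin_nat_mul_pi]
  simp

theorem sum_int_Ioo_eq_sum_nat {M : Type*} [AddCommMonoid M] (N : ℕ) (f : ℤ → M) :
    ∑ v ∈ Ioo (0 : ℤ) N, f v = ∑ i ∈ Ioo 0 N, f (i : ℤ) := by
  symm
  apply sum_nbij (fun i : ℕ => (i : ℤ))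
  · intro i; simp
  · intro i _ j _; simp
  · intro v hv
    simp only [coe_Ioo, Set.mem_Ioo, Set.mem_image] at hv ⊢
    exact ⟨v.toNat, by omega, by omega⟩
  · simp

/-- The first sine function is an eigenfunction of the kernel. -/
theorem sum_sineKernel_mul_sin {N : ℕ} (hN : 2 ≤ N) (m : ℕ) (x : ℝ) :
    ∑ v ∈ Ioo (0 : ℤ) N, sineKernel N m x v * Real.sin (Real.pi / N * v)
      = Real.cos (Real.pi / N) ^ m * Real.sin (Real.pi / N * x) := by
  have hN' : (N : ℝ) ≠ 0 := by
    have : N ≠ 0 := by omega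
    exact_mod_cast this
  rw [sum_int_Ioo_eq_sum_nat]
  simp only [sineKernel, mul_sum, sum_mul]
  rw [sum_comm]
  have inner : ∀ k ∈ Ioo 0 N, ∑ i ∈ Ioo 0 N, 2 / (N : ℝ) * (Real.cos (Real.pi * k / N) ^ m
        * (Real.sin (Real.pi * k / N * x) * Real.sin (Real.pi * k / N * ((i : ℤ) : ℝ))))
        * Real.sin (Real.pi / N * ((i : ℤ) : ℝ))
      = if k = 1 then Real.cos (Real.pi / N) ^ m * Real.sin (Real.pi / N * x) else 0 := by
    intro k hk
    rw [mem_Ioo] at hk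
    have o := sum_sin_mul_sin (N := N) k 1 (by omega) (by omega) (by omega) (by omega)
    have e : ∀ i : ℕ, 2 / (N : ℝ) * (Real.cos (Real.pi * k / N) ^ m
        * (Real.sin (Real.pi * k / N * x) * Real.sin (Real.pi * k / N * ((i : ℤ) : ℝ))))
        * Real.sin (Real.pi / N * ((i : ℤ) : ℝ))
        = 2 / (N : ℝ) * (Real.cos (Real.pi * k / N) ^ m * Real.sin (Real.pi * k / N * x))
          * (Real.sin (Real.pi * i / N * ((k : ℤ) : ℝ))
            * Real.sin (Real.pi * i / N * ((1 : ℤ) : ℝ))) := by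
      intro i
      have a1 : Real.pi * i / N * ((k : ℤ) : ℝ) = Real.pi * k / N * ((i : ℤ) : ℝ) := by
        push_cast; ring
      have a2 : Real.pi * i / N * ((1 : ℤ) : ℝ) = Real.pi / N * ((i : ℤ) : ℝ) := by
        push_cast; ring
      rw [a1, a2]; ring
    rw [sum_congr rfl fun i _ => e i, ← mul_sum, o]
    by_cases h : k = 1
    · subst h
      simp
      field_simp
    · have : ¬ ((k : ℤ) = 1) := by omega
      simp [h, this]
  rw [sum_congr rfl inner, sum_ite_eq' (Ioo 0 N) 1]
  simp [show 1 < N by omega]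

theorem antitoneOn_cos_mul_exp_sq :
    AntitoneOn (fun u : ℝ => Real.cos u * Real.exp (u ^ 2 / 2)) (Set.Icc 0 (Real.pi / 2)) := by
  have hd : ∀ u : ℝ, HasDerivAt (fun u : ℝ => Real.cos u * Real.exp (u ^ 2 / 2))
      ((u * Real.cos u - Real.sin u) * Real.exp (u ^ 2 / 2)) u := by
    intro u
    have h2 : HasDerivAt (fun u : ℝ => u ^ 2 / 2) u u := by
      simpa using (hasDerivAt_pow 2 u).div_const 2
    refine ((Real.hasDerivAt_cos u).mul h2.exp).congr_deriv ?_
    ring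
  apply antitoneOn_of_deriv_nonpos (convex_Icc _ _)
  · exact fun u _ => (hd u).continuousAt.continuousWithinAt
  · exact fun u _ => (hd u).differentiableAt.differentiableWithinAt
  · intro u hu
    rw [interior_Icc] at hu
    rw [(hd u).deriv]
    apply mul_nonpos_of_nonpos_of_nonneg _ (Real.exp_pos _).le
    have hc := Real.cos_pos_of_mem_Ioo ⟨by linarith [hu.1, Real.pi_pos], hu.2⟩
    have ht := Real.le_tan hu.1.le hu.2
    rw [Real.tan_eq_sin_div_cos, le_div_iff₀ hc] at ht
    linarith

theorem abs_sin_natCast_mul_le (k : ℕ) (u : ℝ) : |Real.sin (k * u)| ≤ k * |Real.sin u| := by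
  induction k with
  | zero => simp
  | succ k ih =>
    have : ((k + 1 : ℕ) : ℝ) * u = k * u + u := by push_cast; ring
    rw [this, Real.sin_add]
    calc _ ≤ |Real.sin (k * u)| * |Real.cos u| + |Real.cos (k * u)| * |Real.sin u| := by
          rw [← abs_mul, ← abs_mul]; exact abs_add_le _ _
      _ ≤ k * |Real.sin u| * 1 + 1 * |Real.sin u| := by
          gcongr
          · exact Real.abs_cos_le_one _
          · exact Real.abs_cos_le_one _
      _ = _ := by push_cast; ring

theorem abs_spectral_term_le {N m k : ℕ} (hm : 10 * N ^ 2 ≤ m) (hk : 2 ≤ k) (hkN : 2 * k ≤ N)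
    (x y : ℝ) :
    |Real.cos (Real.pi * k / N) ^ m
        * (Real.sin (Real.pi * k / N * x) * Real.sin (Real.pi * k / N * y))|
      ≤ 1 / 200 * ((k : ℝ) ^ 2)⁻¹ * (Real.cos (Real.pi / N) ^ m
        * (|Real.sin (Real.pi / N * x)| * |Real.sin (Real.pi / N * y)|)) := by
  have hpi := Real.pi_pos
  have hpi3 := Real.pi_gt_three
  have hN : (0 : ℝ) < N := by
    have : 0 < N := by omega
    exact_mod_cast this
  have hk' : (2 : ℝ) ≤ k := by exact_mod_cast hk
  have hkN' : 2 * (k : ℝ) ≤ N := by exact_mod_cast hkN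
  have hm' : 10 * (N : ℝ) ^ 2 ≤ m := by exact_mod_cast hm
  have hu2 : Real.pi * k / N ≤ Real.pi / 2 := by
    rw [div_le_div_iff₀ hN two_pos]; nlinarith
  have hu12 : Real.pi / N ≤ Real.pi * k / N := by
    gcongr; nlinarith
  have hc2 : 0 ≤ Real.cos (Real.pi * k / N) :=
    Real.cos_nonneg_of_mem_Icc ⟨by have : 0 ≤ Real.pi * k / N := by positivity
                                   linarith, hu2⟩
  have hmono := antitoneOn_cos_mul_exp_sq ⟨by positivity, hu12.trans hu2⟩
    ⟨by positivity, hu2⟩ hu12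
  simp only at hmono
  have hcos : Real.cos (Real.pi * k / N)
      ≤ Real.cos (Real.pi / N) * Real.exp (-((k ^ 2 - 1) * (Real.pi / N) ^ 2 / 2)) := by
    have e : -((k ^ 2 - 1) * (Real.pi / N) ^ 2 / 2)
        = (Real.pi / N) ^ 2 / 2 - (Real.pi * k / N) ^ 2 / 2 := by ring
    rw [e, Real.exp_sub, ← mul_div_assoc, le_div_iff₀ (Real.exp_pos _)]
    exact hmono
  have hc1 : 0 ≤ Real.cos (Real.pi / N) :=
    Real.cos_nonneg_of_mem_Icc ⟨by have : 0 ≤ Real.pi / N := by positivity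
                                   linarith, hu12.trans hu2⟩
  have hexp : Real.exp (-((k ^ 2 - 1) * (Real.pi / N) ^ 2 / 2)) ^ m
      ≤ 1 / 200 * ((k : ℝ) ^ 2)⁻¹ * ((k : ℝ) ^ 2)⁻¹ := by
    rw [← Real.exp_nat_mul]
    have hu : 33 * (k : ℝ) ^ 2 ≤ m * ((k ^ 2 - 1) * (Real.pi / N) ^ 2 / 2) := by
      have h1 : 3 / 4 * (k : ℝ) ^ 2 ≤ k ^ 2 - 1 := by nlinarith
      have h2 : 90 ≤ m * (Real.pi / N) ^ 2 := by
        rw [div_pow, ← mul_div_assoc, le_div_iff₀ (by positivity)]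
        nlinarith [mul_le_mul hm' (show (9 : ℝ) ≤ Real.pi ^ 2 by nlinarith) (by norm_num)
          (by positivity)]
      nlinarith [mul_le_mul h2 h1 (by positivity) (by positivity)]
    have h3 := Real.quadratic_le_exp_of_nonneg (show (0 : ℝ) ≤ 33 * (k : ℝ) ^ 2 by positivity)
    have h4 : 200 * (k : ℝ) ^ 2 * k ^ 2 ≤ Real.exp (33 * (k : ℝ) ^ 2) := by nlinarith
    calc Real.exp (m * -((k ^ 2 - 1) * (Real.pi / N) ^ 2 / 2))
        ≤ Real.exp (-(33 * (k : ℝ) ^ 2)) := Real.exp_le_exp.2 (by linarith)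
      _ = (Real.exp (33 * (k : ℝ) ^ 2))⁻¹ := Real.exp_neg _
      _ ≤ (200 * (k : ℝ) ^ 2 * k ^ 2)⁻¹ := inv_anti₀ (by positivity) h4
      _ = _ := by field_simp
  have hsin : ∀ z : ℝ, |Real.sin (Real.pi * k / N * z)| ≤ k * |Real.sin (Real.pi / N * z)| := by
    intro z
    have := abs_sin_natCast_mul_le k (Real.pi / N * z)
    have e : Real.pi * k / N * z = k * (Real.pi / N * z) := by ring
    rwa [e]
  rw [abs_mul, abs_mul, abs_of_nonneg (pow_nonneg hc2 m)]
  calc _ ≤ (Real.cos (Real.pi / N) ^ m * (1 / 200 * ((k : ℝ) ^ 2)⁻¹ * ((k : ℝ) ^ 2)⁻¹))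
        * ((k * |Real.sin (Real.pi / N * x)|) * (k * |Real.sin (Real.pi / N * y)|)) := by
        gcongr
        · calc _ ≤ (Real.cos (Real.pi / N)
                * Real.exp (-((k ^ 2 - 1) * (Real.pi / N) ^ 2 / 2))) ^ m := by gcongr
            _ = Real.cos (Real.pi / N) ^ m
                * Real.exp (-((k ^ 2 - 1) * (Real.pi / N) ^ 2 / 2)) ^ m := mul_pow _ _ _
            _ ≤ _ := by gcongr
        · exact hsin x
        · exact hsin y
    _ = _ := by field_simp

theorem cos_pi_mul_sub_div {N k : ℕ} (hk : k ≤ N) (hN : N ≠ 0) :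
    Real.cos (Real.pi * (N - k : ℕ) / N) = -Real.cos (Real.pi * k / N) := by
  have hN' : (N : ℝ) ≠ 0 := by exact_mod_cast hN
  have : Real.pi * (N - k : ℕ) / N = Real.pi - Real.pi * k / N := by
    rw [Nat.cast_sub hk]; field_simp
  rw [this, Real.cos_pi_sub]

theorem sin_pi_mul_sub_div {N k : ℕ} (hk : k ≤ N) (hN : N ≠ 0) (x : ℤ) :
    Real.sin (Real.pi * (N - k : ℕ) / N * x)
      = -(Real.cos (Real.pi * x) * Real.sin (Real.pi * k / N * x)) := by
  have hN' : (N : ℝ) ≠ 0 := by exact_mod_cast hN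
  have : Real.pi * (N - k : ℕ) / N * x = x * Real.pi - Real.pi * k / N * x := by
    rw [Nat.cast_sub hk]; field_simp
  rw [this, Real.sin_sub, Real.sin_int_mul_pi, mul_comm (x : ℝ)]
  ring

theorem abs_cos_pi_mul_int (x : ℤ) : |Real.cos (Real.pi * x)| = 1 := by
  rw [mul_comm, Real.cos_int_mul_pi]
  simp

theorem sin_pi_div_mul_pos {N : ℕ} {x : ℤ} (hx : 0 < x) (hxN : x < N) :
    0 < Real.sin (Real.pi / N * x) := by
  have hx' : (0 : ℝ) < x := by exact_mod_cast hx
  have hxN' : (x : ℝ) < N := by exact_mod_cast hxN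
  have hN : (0 : ℝ) < N := hx'.trans hxN'
  apply Real.sin_pos_of_pos_of_lt_pi
  · have := Real.pi_pos
    positivity
  · rw [div_mul_eq_mul_div, div_lt_iff₀ hN]
    exact mul_lt_mul_of_pos_left hxN' Real.pi_pos

theorem sineKernel_le {N m : ℕ} (hN : 4 ≤ N) (hm : 10 * N ^ 2 ≤ m) {x y : ℤ}
    (hx : 0 < x) (hxN : x < N) (hy : 0 < y) (hyN : y < N) :
    sineKernel N m x y ≤ 2 / N * (Real.cos (Real.pi / N) ^ m
      * (Real.sin (Real.pi / N * x) * Real.sin (Real.pi / N * y)))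
      * (1 + (-1) ^ m * Real.cos (Real.pi * x) * Real.cos (Real.pi * y) + 1 / 100) := by
  have hN0 : N ≠ 0 := by omega
  have hsx := sin_pi_div_mul_pos hx hxN
  have hsy := sin_pi_div_mul_pos hy hyN
  set A := Real.cos (Real.pi / N) ^ m
      * (Real.sin (Real.pi / N * x) * Real.sin (Real.pi / N * y)) with hA
  set T : ℕ → ℝ := fun k => Real.cos (Real.pi * k / N) ^ m
    * (Real.sin (Real.pi * k / N * x) * Real.sin (Real.pi * k / N * y)) with hT
  have hA0 : 0 ≤ A := by
    have : 0 ≤ Real.cos (Real.pi / N) := by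
      apply Real.cos_nonneg_of_mem_Icc
      have hN' : (4 : ℝ) ≤ N := by exact_mod_cast hN
      have := Real.pi_pos
      constructor
      · have : 0 ≤ Real.pi / N := by positivity
        linarith
      · gcongr; linarith
    positivity
  have hT1 : T 1 = A := by simp [hT, hA]
  have hTlast : T (N - 1) = (-1) ^ m * Real.cos (Real.pi * x) * Real.cos (Real.pi * y) * A := by
    simp only [hT]
    rw [cos_pi_mul_sub_div (by omega) hN0, sin_pi_mul_sub_div (by omega) hN0,
      sin_pi_mul_sub_div (by omega) hN0, hA, neg_pow]
    push_cast
    rw [mul_one]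
    ring
  have hsmall : ∀ k : ℕ, 2 ≤ k → 2 * k ≤ N → |T k| ≤ 1 / 200 * ((k : ℝ) ^ 2)⁻¹ * A := by
    intro k hk hkN
    have := abs_spectral_term_le hm hk hkN x y
    rwa [abs_of_pos hsx, abs_of_pos hsy] at this
  have hmid : ∀ k ∈ Ioo 1 (N - 1), T k
      ≤ 1 / 200 * A * (((k : ℝ) ^ 2)⁻¹ + (((N - k : ℕ) : ℝ) ^ 2)⁻¹) := by
    intro k hk
    rw [mem_Ioo] at hk
    have p1 : 0 ≤ 1 / 200 * A * ((k : ℝ) ^ 2)⁻¹ := by positivity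
    have p2 : 0 ≤ 1 / 200 * A * (((N - k : ℕ) : ℝ) ^ 2)⁻¹ := by positivity
    rcases le_total (2 * k) N with h | h
    · have := (le_abs_self _).trans (hsmall k (by omega) h)
      linarith
    · have h3 : |T k| = |T (N - k)| := by
        simp only [hT]
        rw [cos_pi_mul_sub_div (by omega) hN0, sin_pi_mul_sub_div (by omega) hN0,
          sin_pi_mul_sub_div (by omega) hN0]
        simp only [abs_mul, abs_pow, abs_neg, abs_cos_pi_mul_int, one_mul]
      have := (le_abs_self _).trans (h3.le.trans (hsmall (N - k) (by omega) (by omega)))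
      linarith
  have hsum1 : ∑ k ∈ Ioo 1 (N - 1), ((k : ℝ) ^ 2)⁻¹ ≤ 1 := by
    have := sum_Ioo_inv_sq_le (α := ℝ) 1 (N - 1)
    norm_num at this
    simpa using this
  have hsum2 : ∑ k ∈ Ioo 1 (N - 1), (((N - k : ℕ) : ℝ) ^ 2)⁻¹
      = ∑ k ∈ Ioo 1 (N - 1), ((k : ℝ) ^ 2)⁻¹ := by
    apply sum_nbij' (fun k => N - k) (fun k => N - k)
    · intro k hk; rw [mem_Ioo] at hk ⊢; omega
    · intro k hk; rw [mem_Ioo] at hk ⊢; omega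
    · intro k hk; rw [mem_Ioo] at hk; omega
    · intro k hk; rw [mem_Ioo] at hk; omega
    · intro k _; rfl
  have hsplit : Ioo 0 N = insert 1 (insert (N - 1) (Ioo 1 (N - 1))) := by
    ext k; simp only [mem_Ioo, mem_insert]; omega
  have hrest : ∑ k ∈ Ioo 1 (N - 1), T k ≤ 1 / 100 * A := by
    calc _ ≤ _ := sum_le_sum hmid
      _ = 1 / 200 * A * (∑ k ∈ Ioo 1 (N - 1), ((k : ℝ) ^ 2)⁻¹
          + ∑ k ∈ Ioo 1 (N - 1), ((k : ℝ) ^ 2)⁻¹) := by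
          rw [← mul_sum, sum_add_distrib, hsum2]
      _ ≤ 1 / 200 * A * (1 + 1) := by gcongr
      _ = _ := by ring
  have : sineKernel N m x y = 2 / N * ∑ k ∈ Ioo 0 N, T k := rfl
  rw [this, hsplit, sum_insert, sum_insert, hT1, hTlast, mul_assoc (2 / (N : ℝ))]
  · gcongr
    linarith
  · simp
  · simp; omega

theorem two_mul_alternating_sum (g : ℕ → ℝ) (N : ℕ) :
    2 * ∑ i ∈ range N, (-1) ^ i * g i
      = g 0 - (-1) ^ N * g N + ∑ i ∈ range N, (-1) ^ i * (g i - g (i + 1)) := by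
  induction N with
  | zero => simp
  | succ N ih =>
    rw [sum_range_succ, sum_range_succ, mul_add, ih, pow_succ]
    ring

/-- A Riemann sum estimate for a Lipschitz function vanishing at both ends, with an oscillating
weight. -/
theorem sum_mul_weight_le {N : ℕ} {F g : ℝ → ℝ} {L c : ℝ}
    (hF : ∀ u, HasDerivAt F (g u) u) (hL : ∀ u v, |g u - g v| ≤ L * |u - v|)
    (h0 : g 0 = 0) (hN : g N = 0) (hc : |c| ≤ 1) :
    ∑ v ∈ Ioo (0 : ℤ) N, g v * (1 + c * Real.cos (Real.pi * v) + 1 / 100)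
      ≤ 101 / 100 * (F N - F 0 + N * L) + N * L := by
  have e1 : ∑ v ∈ Ioo (0 : ℤ) N, g v * (1 + c * Real.cos (Real.pi * v) + 1 / 100)
      = ∑ i ∈ range N, g i * (1 + c * Real.cos (Real.pi * i) + 1 / 100) := by
    rw [sum_int_Ioo_eq_sum_nat]
    simp only [Int.cast_natCast]
    apply sum_subset
    · intro k; simp
    · intro k hk hk'
      have : k = 0 := by simp at hk hk'; omega
      simp [this, h0]
  have hL0 : 0 ≤ L := by simpa using (abs_nonneg _).trans (hL 1 0)
  have hstep : ∀ i : ℕ, |g i - g (i + 1 : ℕ)| ≤ L := by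
    intro i
    simpa using hL i (i + 1 : ℕ)
  have halt : |∑ i ∈ range N, (-1) ^ i * g i| ≤ N * L := by
    have h2 := two_mul_alternating_sum (fun i => g i) N
    have h3 : |∑ i ∈ range N, (-1) ^ i * (g i - g (i + 1 : ℕ))| ≤ N * L := by
      calc _ ≤ ∑ i ∈ range N, |(-1) ^ i * (g i - g (i + 1 : ℕ))| := abs_sum_le_sum_abs _ _
        _ ≤ ∑ i ∈ range N, L := by
            apply sum_le_sum
            intro i _
            rw [abs_mul, abs_pow, abs_neg, abs_one, one_pow, one_mul]
            exact hstep i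
        _ = N * L := by simp
    simp only [Nat.cast_zero, h0, hN, mul_zero, sub_zero, zero_add] at h2
    rw [← h2, abs_mul, abs_two] at h3
    have := abs_nonneg (∑ i ∈ range N, (-1) ^ i * g i)
    linarith
  have hriem : ∑ i ∈ range N, g i ≤ F N - F 0 + N * L := by
    have h2 : ∀ i : ℕ, g i ≤ F (i + 1 : ℕ) - F i + L := by
      intro i
      have hlt : (i : ℝ) < (i + 1 : ℕ) := by push_cast; linarith
      obtain ⟨u, hu, hu'⟩ := exists_hasDerivAt_eq_slope F g hlt
        (fun u _ => (hF u).continuousAt.continuousWithinAt) (fun u _ => hF u)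
      have h4 := hL i u
      have h5 : |(i : ℝ) - u| ≤ 1 := by
        push_cast at hu
        rw [abs_le]; constructor <;> linarith [hu.1, hu.2]
      have h6 : g u = F (i + 1 : ℕ) - F i := by
        rw [hu']; push_cast; simp
      have h7 := (le_abs_self _).trans (h4.trans (mul_le_mul_of_nonneg_left h5 hL0))
      linarith
    calc _ ≤ ∑ i ∈ range N, (F (i + 1 : ℕ) - F i + L) := sum_le_sum fun i _ => h2 i
      _ = _ := by
        rw [sum_add_distrib, sum_range_sub (fun i : ℕ => F i)]
        simp
  have e2 : ∑ i ∈ range N, g i * (1 + c * Real.cos (Real.pi * i) + 1 / 100)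
      = 101 / 100 * ∑ i ∈ range N, g i + c * ∑ i ∈ range N, (-1) ^ i * g i := by
    rw [mul_sum, mul_sum, ← sum_add_distrib]
    apply sum_congr rfl
    intro i _
    rw [mul_comm Real.pi, Real.cos_nat_mul_pi]
    ring
  rw [e1, e2]
  have h8 : c * ∑ i ∈ range N, (-1) ^ i * g i ≤ N * L := by
    calc _ ≤ |c * ∑ i ∈ range N, (-1) ^ i * g i| := le_abs_self _
      _ = |c| * |∑ i ∈ range N, (-1) ^ i * g i| := abs_mul _ _
      _ ≤ 1 * (N * L) := by gcongr
      _ = _ := one_mul _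
  linarith

theorem abs_sin_mul_sub_sin_mul_le {a : ℝ} (ha : 0 ≤ a) (u v : ℝ) :
    |Real.sin (a * u) - Real.sin (a * v)| ≤ a * |u - v| := by
  have := Real.abs_sin_sub_sin_le (a * u) (a * v)
  rwa [← mul_sub, abs_mul, abs_of_nonneg ha] at this

theorem abs_neg_one_pow_mul_cos_le (m : ℕ) (x : ℤ) : |(-1) ^ m * Real.cos (Real.pi * x)| ≤ 1 := by
  rw [abs_mul, abs_cos_pi_mul_int]
  simp

theorem cos_pi_div_nonneg {N : ℕ} (hN : 2 ≤ N) : 0 ≤ Real.cos (Real.pi / N) := by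
  have hN' : (2 : ℝ) ≤ N := by exact_mod_cast hN
  have hpi := Real.pi_pos
  apply Real.cos_nonneg_of_mem_Icc
  constructor
  · have : 0 ≤ Real.pi / N := by positivity
    linarith
  · gcongr

theorem sum_sineKernel_le {N m : ℕ} (hN : 1000 ≤ N) (hm : 10 * N ^ 2 ≤ m) {x : ℤ}
    (hx : 0 < x) (hxN : x < N) :
    ∑ v ∈ Ioo (0 : ℤ) N, sineKernel N m x v
      ≤ 107 / 100 * (4 / Real.pi)
        * (Real.cos (Real.pi / N) ^ m * Real.sin (Real.pi / N * x)) := by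
  have hN' : (1000 : ℝ) ≤ N := by exact_mod_cast hN
  have hN0 : (0 : ℝ) < N := by linarith
  have hpi := Real.pi_pos
  have hpi4 := Real.pi_le_four
  have hsx := (sin_pi_div_mul_pos hx hxN).le
  have hc := cos_pi_div_nonneg (show 2 ≤ N by omega)
  have hF : ∀ u, HasDerivAt (fun u : ℝ => -(N / Real.pi) * Real.cos (Real.pi / N * u))
      (Real.sin (Real.pi / N * u)) u := by
    intro u
    have h1 : HasDerivAt (fun u : ℝ => Real.pi / N * u) (Real.pi / N) u := by
      simpa using (hasDerivAt_id u).const_mul (Real.pi / N)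
    refine (h1.cos.const_mul (-(N / Real.pi))).congr_deriv ?_
    field_simp
  have hsum := sum_mul_weight_le (N := N) (L := Real.pi / N) hF
    (abs_sin_mul_sub_sin_mul_le (by positivity)) (by simp)
    (by rw [div_mul_cancel₀ _ hN0.ne', Real.sin_pi]) (abs_neg_one_pow_mul_cos_le m x)
  have e1 : -(N / Real.pi) * Real.cos (Real.pi / N * N)
      - -(N / Real.pi) * Real.cos (Real.pi / N * 0) = 2 * N / Real.pi := by
    rw [div_mul_cancel₀ _ hN0.ne', Real.cos_pi, mul_zero, Real.cos_zero]; ring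
  simp only [e1, mul_div_cancel₀ _ hN0.ne'] at hsum
  have hlarge : 101 / 100 * (2 * N / Real.pi + Real.pi) + Real.pi
      ≤ 107 / 100 * (2 * N / Real.pi) := by
    have : 250 ≤ N / Real.pi := by rw [le_div_iff₀ hpi]; linarith
    have e : 2 * N / Real.pi = 2 * (N / Real.pi) := by ring
    rw [e]; linarith
  calc _ ≤ ∑ v ∈ Ioo (0 : ℤ) N, 2 / N * (Real.cos (Real.pi / N) ^ m
      * (Real.sin (Real.pi / N * x) * Real.sin (Real.pi / N * v)))
      * (1 + (-1) ^ m * Real.cos (Real.pi * x) * Real.cos (Real.pi * v) + 1 / 100) := by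
        apply sum_le_sum
        intro v hv
        rw [mem_Ioo] at hv
        exact sineKernel_le (by omega) hm hx hxN hv.1 hv.2
    _ = 2 / N * (Real.cos (Real.pi / N) ^ m * Real.sin (Real.pi / N * x))
        * ∑ v ∈ Ioo (0 : ℤ) N, Real.sin (Real.pi / N * v)
          * (1 + (-1) ^ m * Real.cos (Real.pi * x) * Real.cos (Real.pi * v) + 1 / 100) := by
        rw [mul_sum]
        exact sum_congr rfl fun v _ => by ring
    _ ≤ 2 / N * (Real.cos (Real.pi / N) ^ m * Real.sin (Real.pi / N * x))
        * (107 / 100 * (2 * N / Real.pi)) := by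
        gcongr
        exact hsum.trans hlarge
    _ = _ := by field_simp; ring

theorem sum_sineKernel_mul_sin_half_le {n m : ℕ} (hn : 1000 ≤ n) (hm : 10 * n ^ 2 ≤ m) {x : ℤ}
    (hx : 0 < x) (hxn : x < n) :
    ∑ v ∈ Ioo (0 : ℤ) n, sineKernel n m x v * Real.sin (Real.pi / (2 * n : ℕ) * v)
      ≤ 107 / 100 * (8 / (3 * Real.pi))
        * (Real.cos (Real.pi / n) ^ m * Real.sin (Real.pi / n * x)) := by
  have hn' : (1000 : ℝ) ≤ n := by exact_mod_cast hn
  have hn0 : (0 : ℝ) < n := by linarith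
  have hpi := Real.pi_pos
  have hpi4 := Real.pi_le_four
  have hsx := (sin_pi_div_mul_pos hx hxn).le
  have hc := cos_pi_div_nonneg (show 2 ≤ n by omega)
  set φ := Real.pi / (2 * n : ℕ) with hφ
  have hφ0 : 0 ≤ φ := by positivity
  have hθφ : Real.pi / n = 2 * φ := by rw [hφ]; push_cast; field_simp
  have hφn : φ * n = Real.pi / 2 := by rw [hφ]; push_cast; field_simp
  have hF : ∀ u, HasDerivAt (fun u : ℝ => 4 * n / (3 * Real.pi) * Real.sin (φ * u) ^ 3)
      (Real.sin (Real.pi / n * u) * Real.sin (φ * u)) u := by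
    intro u
    have h1 : HasDerivAt (fun u : ℝ => φ * u) φ u := by
      simpa using (hasDerivAt_id u).const_mul φ
    refine ((h1.sin.pow 3).const_mul (4 * n / (3 * Real.pi))).congr_deriv ?_
    rw [hθφ, mul_assoc 2 φ, Real.sin_two_mul]
    have : 4 * n / (3 * Real.pi) * (3 * φ) = 2 := by
      rw [hφ]; push_cast; field_simp; norm_num
    push_cast
    linear_combination (Real.sin (φ * u) ^ 2 * Real.cos (φ * u)) * this
  have hL : ∀ u v : ℝ, |Real.sin (Real.pi / n * u) * Real.sin (φ * u)
      - Real.sin (Real.pi / n * v) * Real.sin (φ * v)| ≤ (Real.pi / n + φ) * |u - v| := by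
    intro u v
    have e : Real.sin (Real.pi / n * u) * Real.sin (φ * u)
        - Real.sin (Real.pi / n * v) * Real.sin (φ * v)
        = (Real.sin (Real.pi / n * u) - Real.sin (Real.pi / n * v)) * Real.sin (φ * u)
          + Real.sin (Real.pi / n * v) * (Real.sin (φ * u) - Real.sin (φ * v)) := by ring
    rw [e]
    calc _ ≤ |Real.sin (Real.pi / n * u) - Real.sin (Real.pi / n * v)| * |Real.sin (φ * u)|
          + |Real.sin (Real.pi / n * v)| * |Real.sin (φ * u) - Real.sin (φ * v)| := by
          rw [← abs_mul, ← abs_mul]; exact abs_add_le _ _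
      _ ≤ (Real.pi / n * |u - v|) * 1 + 1 * (φ * |u - v|) := by
          gcongr
          · exact abs_sin_mul_sub_sin_mul_le (by positivity) u v
          · exact Real.abs_sin_le_one _
          · exact Real.abs_sin_le_one _
          · exact abs_sin_mul_sub_sin_mul_le hφ0 u v
      _ = _ := by ring
  have hsum := sum_mul_weight_le (N := n) hF hL (by simp)
    (by rw [div_mul_cancel₀ _ hn0.ne', Real.sin_pi, zero_mul]) (abs_neg_one_pow_mul_cos_le m x)
  have e1 : 4 * n / (3 * Real.pi) * Real.sin (φ * n) ^ 3
      - 4 * n / (3 * Real.pi) * Real.sin (φ * 0) ^ 3 = 4 * n / (3 * Real.pi) := by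
    rw [hφn, Real.sin_pi_div_two, mul_zero, Real.sin_zero]; ring
  have e2 : n * (Real.pi / n + φ) = 3 / 2 * Real.pi := by
    rw [mul_add, mul_comm (n : ℝ) φ, hφn]; field_simp; ring
  simp only [e1, e2] at hsum
  have hlarge : 101 / 100 * (4 * n / (3 * Real.pi) + 3 / 2 * Real.pi) + 3 / 2 * Real.pi
      ≤ 107 / 100 * (4 * n / (3 * Real.pi)) := by
    have : 250 ≤ n / Real.pi := by rw [le_div_iff₀ hpi]; linarith
    have e : 4 * n / (3 * Real.pi) = 4 / 3 * (n / Real.pi) := by ring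
    rw [e]; linarith
  calc _ ≤ ∑ v ∈ Ioo (0 : ℤ) n, 2 / n * (Real.cos (Real.pi / n) ^ m
      * (Real.sin (Real.pi / n * x) * Real.sin (Real.pi / n * v)))
      * (1 + (-1) ^ m * Real.cos (Real.pi * x) * Real.cos (Real.pi * v) + 1 / 100)
      * Real.sin (φ * v) := by
        apply sum_le_sum
        intro v hv
        rw [mem_Ioo] at hv
        have hsv : 0 ≤ Real.sin (φ * v) :=
          (sin_pi_div_mul_pos hv.1 (by push_cast; omega)).le
        gcongr
        exact sineKernel_le (by omega) hm hx hxn hv.1 hv.2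
    _ = 2 / n * (Real.cos (Real.pi / n) ^ m * Real.sin (Real.pi / n * x))
        * ∑ v ∈ Ioo (0 : ℤ) n, (Real.sin (Real.pi / n * v) * Real.sin (φ * v))
          * (1 + (-1) ^ m * Real.cos (Real.pi * x) * Real.cos (Real.pi * v) + 1 / 100) := by
        rw [mul_sum]
        exact sum_congr rfl fun v _ => by ring
    _ ≤ 2 / n * (Real.cos (Real.pi / n) ^ m * Real.sin (Real.pi / n * x))
        * (107 / 100 * (4 * n / (3 * Real.pi))) := by
        gcongr
        exact hsum.trans hlarge
    _ = _ := by field_simp; ring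

theorem measure_eq_tsum_inter_fiber {Ω : Type*} [MeasurableSpace Ω] (μ : Measure Ω) {f : Ω → ℤ}
    (hf : Measurable f) {E : Set Ω} (hE : MeasurableSet E) :
    μ E = ∑' u, μ (E ∩ {ω | f ω = u}) := by
  rw [← measure_iUnion]
  · congr 1
    ext ω
    simp
  · intro u v huv
    rw [Function.onFun, Set.disjoint_left]
    rintro ω ⟨_, h1⟩ ⟨_, h2⟩
    exact huv (h1.symm.trans h2)
  · exact fun u => hE.inter (hf (measurableSet_singleton u))

/-- The event that the process stays in the time-dependent region `A` up to time `t`. -/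
def staysIn {Ω : Type*} (S : ℕ → Ω → ℤ) (A : ℕ → Set ℤ) (t : ℕ) : Set Ω :=
  {ω | ∀ s ≤ t, S s ω ∈ A s}

section

variable {Ω : Type*} [MeasurableSpace Ω] {P : ℤ → Measure Ω} {S : ℕ → Ω → ℤ}

theorem measurableSet_staysIn (hS : ∀ t, Measurable (S t)) (A : ℕ → Set ℤ) (t : ℕ) :
    MeasurableSet (staysIn S A t) := by
  have : staysIn S A t = ⋂ s, ⋂ (_ : s ≤ t), S s ⁻¹' A s := by
    ext ω; simp [staysIn]
  rw [this]
  exact MeasurableSet.iInter fun s => MeasurableSet.iInter fun _ =>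
    hS s (MeasurableSet.of_discrete)

theorem IsSRW.measure_start (hS : IsSRW P S) (x : ℤ) : P x {ω | S 0 ω = x} = 1 := by
  simpa using hS.2.2 x 0 (fun _ => x) rfl

theorem IsSRW.measure_start_compl (hS : IsSRW P S) (x : ℤ) : P x {ω | S 0 ω ≠ x} = 0 := by
  have := hS.1 x
  have h := (prob_compl_eq_zero_iff (μ := P x) (s := {ω | S 0 ω = x})
    (hS.2.1 0 (measurableSet_singleton x))).2 (hS.measure_start x)
  exact h

theorem IsSRW.measure_path_inter_step (hS : IsSRW P S) (x : ℤ) (t : ℕ) (γ : Fin (t + 1) → ℤ)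
    (v : ℤ) :
    P x ((fun ω (i : Fin (t + 1)) => S i ω) ⁻¹' {γ} ∩ {ω | S (t + 1) ω = v})
      = srwStep (γ (Fin.last t)) v * P x ((fun ω (i : Fin (t + 1)) => S i ω) ⁻¹' {γ}) := by
  by_cases h0 : γ 0 = x
  · set γ' : ℕ → ℤ := fun s => if h : s < t + 1 then γ ⟨s, h⟩ else v with hγ'
    have hlt : ∀ s (h : s < t + 1), γ' s = γ ⟨s, h⟩ := fun s h => dif_pos h
    have hv : γ' (t + 1) = v := by simp [hγ']
    have h0' : γ' 0 = x := by rw [hlt 0 (by omega)]; exact h0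
    have e1 : (fun ω (i : Fin (t + 1)) => S i ω) ⁻¹' {γ} = {ω | ∀ s ≤ t, S s ω = γ' s} := by
      ext ω
      simp only [Set.mem_preimage, Set.mem_singleton_iff, Set.mem_ofPred_eq, funext_iff]
      constructor
      · intro h s hs
        rw [hlt s (by omega)]
        exact h ⟨s, by omega⟩
      · intro h i
        rw [h i (by omega), hlt i i.2]
    have e2 : {ω | ∀ s ≤ t, S s ω = γ' s} ∩ {ω | S (t + 1) ω = v}
        = {ω | ∀ s ≤ t + 1, S s ω = γ' s} := by
      ext ω
      simp only [Set.mem_inter_iff, Set.mem_ofPred_eq]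
      constructor
      · rintro ⟨h1, h2⟩ s hs
        rcases Nat.le_succ_iff.1 hs with h | rfl
        · exact h1 s h
        · rw [hv]; exact h2
      · exact fun h => ⟨fun s hs => h s (by omega), by rw [h (t + 1) le_rfl, hv]⟩
    rw [e1, e2, hS.2.2 x _ γ' h0', hS.2.2 x _ γ' h0', prod_range_succ, hv, hlt t (by omega),
      mul_comm]
    rfl
  · have hz : P x ((fun ω (i : Fin (t + 1)) => S i ω) ⁻¹' {γ}) = 0 := by
      apply measure_mono_null _ (hS.measure_start_compl x)
      rintro ω rfl
      exact h0
    rw [hz, mul_zero]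
    exact measure_mono_null Set.inter_subset_left hz

theorem IsSRW.measure_staysIn_inter_step (hS : IsSRW P S) (x : ℤ) (A : ℕ → Set ℤ) (t : ℕ)
    (u v : ℤ) :
    P x (staysIn S A t ∩ {ω | S t ω = u} ∩ {ω | S (t + 1) ω = v})
      = srwStep u v * P x (staysIn S A t ∩ {ω | S t ω = u}) := by
  set X : Ω → Fin (t + 1) → ℤ := fun ω i => S i ω with hX
  have hXm : Measurable X := measurable_pi_lambda _ fun i => hS.2.1 i
  have hlast : MeasurableSet {γ : Fin (t + 1) → ℤ | γ (Fin.last t) = u} := MeasurableSet.of_discrete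
  have key : (((P x).restrict {ω | S (t + 1) ω = v}).map X).restrict {γ | γ (Fin.last t) = u}
      = srwStep u v • ((P x).map X).restrict {γ | γ (Fin.last t) = u} := by
    apply Measure.ext_of_singleton
    intro γ
    have hm : MeasurableSet ({γ} ∩ {γ : Fin (t + 1) → ℤ | γ (Fin.last t) = u}) :=
      MeasurableSet.of_discrete
    rw [Measure.smul_apply, Measure.restrict_apply (measurableSet_singleton γ),
      Measure.restrict_apply (measurableSet_singleton γ), Measure.map_apply hXm hm,
      Measure.map_apply hXm hm, Measure.restrict_apply (hXm hm), smul_eq_mul]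
    by_cases hγ : γ (Fin.last t) = u
    · have : {γ} ∩ {γ : Fin (t + 1) → ℤ | γ (Fin.last t) = u} = {γ} := by
        rw [Set.inter_eq_left]
        rintro _ rfl
        exact hγ
      rw [this, ← hγ]
      exact hS.measure_path_inter_step x t γ v
    · have : {γ} ∩ {γ : Fin (t + 1) → ℤ | γ (Fin.last t) = u} = ∅ := by
        rw [Set.eq_empty_iff_forall_notMem]
        rintro _ ⟨rfl, h⟩
        exact hγ h
      simp [this]
  have hB : MeasurableSet {γ : Fin (t + 1) → ℤ | ∀ i : Fin (t + 1), γ i ∈ A i} := MeasurableSet.of_discrete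
  have hpre : X ⁻¹' ({γ | ∀ i : Fin (t + 1), γ i ∈ A i} ∩ {γ | γ (Fin.last t) = u})
      = staysIn S A t ∩ {ω | S t ω = u} := by
    ext ω
    simp only [Set.mem_preimage, Set.mem_inter_iff, Set.mem_ofPred_eq, staysIn, hX, Fin.val_last]
    refine and_congr_left fun _ => ⟨fun h s hs => h ⟨s, by omega⟩, fun h i => h i (by omega)⟩
  have := congrArg (fun μ => μ {γ : Fin (t + 1) → ℤ | ∀ i : Fin (t + 1), γ i ∈ A i}) key
  simp only [Measure.smul_apply, smul_eq_mul] at this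
  rwa [Measure.restrict_apply hB, Measure.restrict_apply hB, Measure.map_apply hXm (hB.inter hlast),
    Measure.map_apply hXm (hB.inter hlast), Measure.restrict_apply (hXm (hB.inter hlast)),
    hpre] at this

/-- The mass at `v` at time `t` of the walk started at `x` and killed when it leaves the
time-dependent region `A`. -/
noncomputable def killedMass (P : ℤ → Measure Ω) (S : ℕ → Ω → ℤ) (x : ℤ) (A : ℕ → Set ℤ) (t : ℕ)
    (v : ℤ) : ℝ :=
  (P x).real (staysIn S A t ∩ {ω | S t ω = v})

theorem IsSRW.killedMass_zero (hS : IsSRW P S) {x : ℤ} {A : ℕ → Set ℤ} (hx : x ∈ A 0) (v : ℤ) :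
    killedMass P S x A 0 v = if v = x then 1 else 0 := by
  unfold killedMass Measure.real
  split_ifs with h
  · subst h
    have : staysIn S A 0 ∩ {ω | S 0 ω = v} = {ω | S 0 ω = v} := by
      rw [Set.inter_eq_right]
      intro ω hω s hs
      obtain rfl : s = 0 := by omega
      rw [Set.mem_ofPred_eq] at hω
      rwa [hω]
    rw [this, hS.measure_start]
    simp
  · have : P x (staysIn S A 0 ∩ {ω | S 0 ω = v}) = 0 := by
      apply measure_mono_null _ (hS.measure_start_compl x)
      rintro ω ⟨_, h2⟩ h3
      exact h (h2.symm.trans h3)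
    simp [this]

theorem IsSRW.killedMass_succ (hS : IsSRW P S) (x : ℤ) (A : ℕ → Set ℤ) (t : ℕ) {v : ℤ}
    (hv : v ∈ A (t + 1)) :
    killedMass P S x A (t + 1) v
      = (killedMass P S x A t (v - 1) + killedMass P S x A t (v + 1)) / 2 := by
  have := hS.1 x
  have e : staysIn S A (t + 1) ∩ {ω | S (t + 1) ω = v}
      = staysIn S A t ∩ {ω | S (t + 1) ω = v} := by
    ext ω
    simp only [staysIn, Set.mem_inter_iff, Set.mem_ofPred_eq]
    refine and_congr_left fun h => ⟨fun h1 s hs => h1 s (by omega), fun h1 s hs => ?_⟩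
    rcases Nat.le_succ_iff.1 hs with h2 | rfl
    · exact h1 s h2
    · rwa [← h] at hv
  have hm : MeasurableSet (staysIn S A t ∩ {ω | S (t + 1) ω = v}) :=
    (measurableSet_staysIn hS.2.1 A t).inter (hS.2.1 _ (measurableSet_singleton v))
  have hval : P x (staysIn S A t ∩ {ω | S (t + 1) ω = v})
      = 1 / 2 * P x (staysIn S A t ∩ {ω | S t ω = v - 1})
        + 1 / 2 * P x (staysIn S A t ∩ {ω | S t ω = v + 1}) := by
    rw [measure_eq_tsum_inter_fiber _ (hS.2.1 t) hm]
    simp only [Set.inter_right_comm _ {ω | S (t + 1) ω = v}]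
    simp only [hS.measure_staysIn_inter_step]
    rw [tsum_eq_sum (s := {v - 1, v + 1}), sum_pair (by omega)]
    · simp [srwStep]
    · intro u hu
      have : ¬ (v = u + 1 ∨ v = u - 1) := by
        simp only [mem_insert, Finset.mem_singleton] at hu
        omega
      simp [srwStep, this]
  unfold killedMass Measure.real
  rw [e, hval, ENNReal.toReal_add (by finiteness) (by finiteness), ENNReal.toReal_mul,
    ENNReal.toReal_mul]
  simp
  ring

theorem killedMass_eq_zero (x : ℤ) {A : ℕ → Set ℤ} {t : ℕ} {v : ℤ} (hv : v ∉ A t) :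
    killedMass P S x A t v = 0 := by
  have : staysIn S A t ∩ {ω | S t ω = v} = ∅ := by
    rw [Set.eq_empty_iff_forall_notMem]
    rintro ω ⟨h1, h2⟩
    exact hv (h2 ▸ h1 t le_rfl)
  simp [killedMass, this]

theorem killedMass_nonneg (x : ℤ) (A : ℕ → Set ℤ) (t : ℕ) (v : ℤ) :
    0 ≤ killedMass P S x A t v := measureReal_nonneg

theorem IsSRW.measure_staysIn_eq_sum (hS : IsSRW P S) (x : ℤ) (A : ℕ → Set ℤ) (t : ℕ)
    (s : Finset ℤ) (h : ∀ v ∉ s, killedMass P S x A t v = 0) :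
    (P x).real (staysIn S A t) = ∑ v ∈ s, killedMass P S x A t v := by
  have := hS.1 x
  rw [measureReal_def, measure_eq_tsum_inter_fiber _ (hS.2.1 t) (measurableSet_staysIn hS.2.1 A t),
    tsum_eq_sum (s := s), ENNReal.toReal_sum (by finiteness)]
  · rfl
  · intro v hv
    exact (measureReal_eq_zero_iff).1 (h v hv)

/-- Evolution of the killed mass while the region is delimited by the absorbing sites `0`, `N`. -/
theorem IsSRW.killedMass_add (hS : IsSRW P S) (x : ℤ) (A : ℕ → Set ℤ) {N a r : ℕ}
    (h0 : ∀ s, a < s → s ≤ a + r → (0 : ℤ) ∉ A s ∧ (N : ℤ) ∉ A s)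
    (hin : ∀ s, a < s → s ≤ a + r → ∀ v, 0 < v → v < (N : ℤ) → v ∈ A s)
    (ha : ∀ v ∉ Ioo (0 : ℤ) N, killedMass P S x A a v = 0) (w : ℤ) :
    killedMass P S x A (a + r) w = if w ∈ Ioo (0 : ℤ) N then
      ∑ v ∈ Ioo (0 : ℤ) N, killedMass P S x A a v * sineKernel N r v w else 0 := by
  induction r generalizing w with
  | zero =>
    split_ifs with hw
    · have hw' := mem_Ioo.1 hw
      have : ∀ v ∈ Ioo (0 : ℤ) N, killedMass P S x A a v * sineKernel N 0 v w
          = if v = w then killedMass P S x A a v else 0 := by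
        intro v hv
        have hv' := mem_Ioo.1 hv
        rw [sineKernel_zero v w hv'.1 hv'.2 hw'.1 hw'.2]
        simp
      rw [sum_congr rfl this, sum_ite_eq' _ w, if_pos hw, add_zero]
    · exact ha w hw
  | succ r ih =>
    replace ih := fun w => ih (fun s h1 h2 => h0 s h1 (by omega))
      (fun s h1 h2 => hin s h1 (by omega)) w
    obtain ⟨hz, hN⟩ := h0 (a + (r + 1)) (by omega) le_rfl
    by_cases hwA : w ∈ A (a + (r + 1))
    · have hw0 : w ≠ 0 := by rintro rfl; exact hz hwA
      have hwN : w ≠ N := by rintro rfl; exact hN hwA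
      rw [← add_assoc, hS.killedMass_succ x A (a + r) hwA]
      by_cases hw : w ∈ Ioo (0 : ℤ) N
      · have hw' := mem_Ioo.1 hw
        have ih' : ∀ z : ℤ, 0 ≤ z → z ≤ N → killedMass P S x A (a + r) z
            = ∑ v ∈ Ioo (0 : ℤ) N, killedMass P S x A a v * sineKernel N r v z := by
          intro z hz0 hzN
          rw [ih z]
          split_ifs with h
          · rfl
          · rw [mem_Ioo] at h
            symm
            apply sum_eq_zero
            intro v _
            obtain rfl | rfl : z = 0 ∨ z = N := by omega
            · rw [Int.cast_zero, sineKernel_right_zero, mul_zero]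
            · rw [Int.cast_natCast, sineKernel_right_self, mul_zero]
        rw [if_pos hw, ih' _ (by omega) (by omega), ih' _ (by omega) (by omega),
          ← sum_add_distrib, sum_div]
        apply sum_congr rfl
        intro v _
        rw [sineKernel_succ]
        push_cast
        ring
      · rw [if_neg hw]
        rw [mem_Ioo] at hw
        rw [ih, ih, if_neg, if_neg]
        · simp
        · rw [mem_Ioo]; omega
        · rw [mem_Ioo]; omega
    · rw [killedMass_eq_zero x hwA, if_neg]
      intro hw
      rw [mem_Ioo] at hw
      exact hwA (hin _ (by omega) le_rfl w hw.1 hw.2)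

theorem IsSRW.killedMass_eq_sineKernel (hS : IsSRW P S) {x : ℤ} {A : ℕ → Set ℤ} {N r : ℕ}
    (hx : 0 < x) (hxN : x < N)
    (h0 : ∀ s ≤ r, (0 : ℤ) ∉ A s ∧ (N : ℤ) ∉ A s)
    (hin : ∀ s ≤ r, ∀ v, 0 < v → v < (N : ℤ) → v ∈ A s) (w : ℤ) :
    killedMass P S x A r w = if w ∈ Ioo (0 : ℤ) N then sineKernel N r x w else 0 := by
  have hinit := hS.killedMass_zero (A := A) (hin 0 (Nat.zero_le r) x hx hxN)
  have hadd := hS.killedMass_add x A (N := N) (a := 0) (r := r)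
    (fun s _ hs => h0 s (by omega)) (fun s _ hs => hin s (by omega))
    (by
      intro v hv
      rw [hinit, if_neg]
      rintro rfl
      exact hv (mem_Ioo.2 ⟨hx, hxN⟩)) w
  rw [zero_add] at hadd
  rw [hadd]
  congr 1
  simp only [hinit, ite_mul, one_mul, zero_mul]
  rw [sum_ite_eq' _ x, if_pos (mem_Ioo.2 ⟨hx, hxN⟩)]

end

section

variable {Ω : Type*} [MeasurableSpace Ω] {P : ℤ → Measure Ω} {S : ℕ → Ω → ℤ}

theorem IsSRW.le_measure_staysIn (hS : IsSRW P S) {N t : ℕ} {x : ℤ} (hx : 0 < x) (hxN : x < N)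
    {A : ℕ → Set ℤ} (h0 : ∀ s ≤ t, (0 : ℤ) ∉ A s ∧ (N : ℤ) ∉ A s)
    (hin : ∀ s ≤ t, ∀ v, 0 < v → v < (N : ℤ) → v ∈ A s) :
    Real.cos (Real.pi / N) ^ t * Real.sin (Real.pi / N * x) ≤ (P x).real (staysIn S A t) := by
  have hmass := hS.killedMass_eq_sineKernel hx hxN h0 hin
  rw [hS.measure_staysIn_eq_sum x A t (Ioo (0 : ℤ) N) (fun v hv => by rw [hmass, if_neg hv]),
    ← sum_sineKernel_mul_sin (by omega) t x]
  apply sum_le_sum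
  intro v hv
  have h := killedMass_nonneg (P := P) (S := S) x A t v
  have hK : killedMass P S x A t v = sineKernel N t x v := by rw [hmass, if_pos hv]
  rw [← hK]
  exact mul_le_of_le_one_right h (Real.sin_le_one _)

theorem IsSRW.measure_staysIn_le (hS : IsSRW P S) {n Δ r : ℕ} (hn : 1000 ≤ n)
    (hΔ : 10 * n ^ 2 ≤ Δ) (hr : 10 * (2 * n) ^ 2 ≤ r) {x : ℤ} (hx : 0 < x) (hxn : x < n) :
    (P x).real (staysIn S
        (fun s => {v : ℤ | v ∉ ({0, (2 * n : ℤ)} : Set ℤ) ∧ (s ≤ Δ → v ≠ n)}) (Δ + r))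
      ≤ 107 / 100 * (4 / Real.pi) * Real.cos (Real.pi / (2 * n : ℕ)) ^ r
        * (107 / 100 * (8 / (3 * Real.pi))
          * (Real.cos (Real.pi / n) ^ Δ * Real.sin (Real.pi / n * x))) := by
  set A : ℕ → Set ℤ := fun s => {v : ℤ | v ∉ ({0, (2 * n : ℤ)} : Set ℤ) ∧ (s ≤ Δ → v ≠ n)} with hA
  have hmem : ∀ s v, v ∈ A s ↔ (v ≠ 0 ∧ v ≠ 2 * n) ∧ (s ≤ Δ → v ≠ n) := by
    intro s v; simp [hA]
  have hmass := hS.killedMass_eq_sineKernel (A := A) (r := Δ) hx hxn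
    (fun s hs => by simp only [hmem]; omega) (fun s hs v h1 h2 => by rw [hmem]; omega)
  have hadd := hS.killedMass_add x A (N := 2 * n) (a := Δ) (r := r)
    (fun s h1 h2 => by simp [hmem])
    (fun s h1 h2 v h3 h4 => by rw [hmem]; push_cast at h4; omega)
    (by
      intro v hv
      rw [hmass, if_neg]
      rw [mem_Ioo] at hv ⊢
      push_cast at hv
      omega)
  rw [hS.measure_staysIn_eq_sum x A (Δ + r) (Ioo (0 : ℤ) (2 * n : ℕ))
    (fun v hv => by rw [hadd, if_neg hv])]
  have hsub : Ioo (0 : ℤ) n ⊆ Ioo (0 : ℤ) (2 * n : ℕ) := by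
    intro v hv
    rw [mem_Ioo] at hv ⊢
    push_cast
    omega
  have hc := cos_pi_div_nonneg (show 2 ≤ 2 * n by omega)
  calc ∑ w ∈ Ioo (0 : ℤ) (2 * n : ℕ), killedMass P S x A (Δ + r) w
      = ∑ w ∈ Ioo (0 : ℤ) (2 * n : ℕ), ∑ v ∈ Ioo (0 : ℤ) (2 * n : ℕ),
          killedMass P S x A Δ v * sineKernel (2 * n) r v w :=
        sum_congr rfl fun w hw => by rw [hadd, if_pos hw]
    _ = ∑ v ∈ Ioo (0 : ℤ) (2 * n : ℕ), killedMass P S x A Δ v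
          * ∑ w ∈ Ioo (0 : ℤ) (2 * n : ℕ), sineKernel (2 * n) r v w := by
        rw [sum_comm]
        simp only [mul_sum]
    _ ≤ ∑ v ∈ Ioo (0 : ℤ) (2 * n : ℕ), killedMass P S x A Δ v
          * (107 / 100 * (4 / Real.pi) * (Real.cos (Real.pi / (2 * n : ℕ)) ^ r
            * Real.sin (Real.pi / (2 * n : ℕ) * v))) := by
        apply sum_le_sum
        intro v hv
        rw [mem_Ioo] at hv
        exact mul_le_mul_of_nonneg_left (sum_sineKernel_le (by omega) hr hv.1 hv.2)
          (killedMass_nonneg x A Δ v)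
    _ = ∑ v ∈ Ioo (0 : ℤ) n, killedMass P S x A Δ v
          * (107 / 100 * (4 / Real.pi) * (Real.cos (Real.pi / (2 * n : ℕ)) ^ r
            * Real.sin (Real.pi / (2 * n : ℕ) * v))) := by
        symm
        apply sum_subset hsub
        intro v _ hv
        rw [hmass, if_neg hv, zero_mul]
    _ = 107 / 100 * (4 / Real.pi) * Real.cos (Real.pi / (2 * n : ℕ)) ^ r
          * ∑ v ∈ Ioo (0 : ℤ) n,
            sineKernel n Δ x v * Real.sin (Real.pi / (2 * n : ℕ) * v) := by
        rw [mul_sum]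
        apply sum_congr rfl
        intro v hv
        rw [hmass, if_pos hv]
        ring
    _ ≤ _ := by
        gcongr
        exact sum_sineKernel_mul_sin_half_le hn hΔ hx hxn

theorem cos_two_mul_pow_le {φ : ℝ} (h0 : 0 ≤ φ) (h1 : 2 * φ ≤ Real.pi / 2) (Δ : ℕ) :
    Real.cos (2 * φ) ^ Δ ≤ Real.cos φ ^ Δ * Real.exp (-(3 * φ ^ 2 / 2 * Δ)) := by
  have hmono := antitoneOn_cos_mul_exp_sq ⟨h0, by linarith⟩ ⟨by linarith, h1⟩
    (show φ ≤ 2 * φ by linarith)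
  simp only at hmono
  have hcos : Real.cos (2 * φ) ≤ Real.cos φ * Real.exp (-(3 * φ ^ 2 / 2)) := by
    have e : -(3 * φ ^ 2 / 2) = φ ^ 2 / 2 - (2 * φ) ^ 2 / 2 := by ring
    rw [e, Real.exp_sub, ← mul_div_assoc, le_div_iff₀ (Real.exp_pos _)]
    exact hmono
  have hnn : 0 ≤ Real.cos (2 * φ) :=
    Real.cos_nonneg_of_mem_Icc ⟨by linarith [Real.pi_pos], h1⟩
  calc _ ≤ (Real.cos φ * Real.exp (-(3 * φ ^ 2 / 2))) ^ Δ := by gcongr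
    _ = _ := by
      rw [mul_pow, ← Real.exp_nat_mul]
      congr 2
      ring

theorem IsSRW.cond_hitting_le (hS : IsSRW P S) {n Δ t : ℕ} (hn : 1000 ≤ n)
    (hΔ : 10 * n ^ 2 ≤ Δ) (ht : Δ + 10 * (2 * n) ^ 2 ≤ t) {x : ℤ} (hx : 0 < x) (hxn : x < n) :
    ProbabilityTheory.cond (P x)
        {ω | ∀ s ≤ t, S s ω ∉ ({0, (2 * n : ℤ)} : Set ℤ)} {ω | ∀ s ≤ Δ, S s ω ≠ (n : ℤ)}
      ≤ ENNReal.ofReal ((8 / Real.pi) * Real.cos (Real.pi * (x : ℝ) / (2 * n))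
          * Real.exp (-3 * Real.pi ^ 2 * (Δ : ℝ) / (8 * (n : ℝ) ^ 2))) := by
  have := hS.1 x
  obtain ⟨r, rfl⟩ := Nat.exists_eq_add_of_le (show Δ ≤ t by omega)
  have hr : 10 * (2 * n) ^ 2 ≤ r := by omega
  have hnum := hS.measure_staysIn_le hn hΔ hr hx hxn
  have hden := hS.le_measure_staysIn (N := 2 * n) (t := Δ + r)
    (A := fun _ => ({0, (2 * n : ℤ)} : Set ℤ)ᶜ) hx (by push_cast; omega)
    (fun s _ => by simp)
    (fun s _ v h1 h2 => by
      simp only [Set.mem_compl_iff, Set.mem_insert_iff, Set.mem_singleton_iff]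
      push_cast at h2
      omega)
  have hinter : {ω | ∀ s ≤ Δ + r, S s ω ∉ ({0, (2 * n : ℤ)} : Set ℤ)}
      ∩ {ω | ∀ s ≤ Δ, S s ω ≠ (n : ℤ)} = staysIn S
        (fun s => {v : ℤ | v ∉ ({0, (2 * n : ℤ)} : Set ℤ) ∧ (s ≤ Δ → v ≠ n)}) (Δ + r) := by
    ext ω
    simp only [staysIn, Set.mem_inter_iff, Set.mem_ofPred_eq]
    constructor
    · exact fun h s hs => ⟨h.1 s hs, h.2 s⟩
    · exact fun h => ⟨fun s hs => (h s hs).1, fun s hs => (h s (by omega)).2 hs⟩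
  have hcondset : {ω | ∀ s ≤ Δ + r, S s ω ∉ ({0, (2 * n : ℤ)} : Set ℤ)}
      = staysIn S (fun _ => ({0, (2 * n : ℤ)} : Set ℤ)ᶜ) (Δ + r) := rfl
  rw [cond_apply (hcondset ▸ measurableSet_staysIn hS.2.1 _ _), hinter, hcondset]
  set a := (P x).real (staysIn S (fun _ => ({0, (2 * n : ℤ)} : Set ℤ)ᶜ) (Δ + r)) with ha
  set b := (P x).real (staysIn S
    (fun s => {v : ℤ | v ∉ ({0, (2 * n : ℤ)} : Set ℤ) ∧ (s ≤ Δ → v ≠ n)}) (Δ + r)) with hb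
  have hn' : (1000 : ℝ) ≤ n := by exact_mod_cast hn
  have hn0 : (0 : ℝ) < n := by linarith
  have hpi := Real.pi_pos
  set φ := Real.pi / (2 * n : ℕ) with hφ
  have hφ0 : 0 < φ := by rw [hφ]; push_cast; positivity
  have hθφ : Real.pi / n = 2 * φ := by rw [hφ]; push_cast; field_simp
  have hφ1 : 2 * φ ≤ Real.pi / 2 := by
    rw [← hθφ]
    gcongr
    linarith
  have hsφ : 0 < Real.sin (φ * x) := sin_pi_div_mul_pos hx (by push_cast; omega)
  have hcφ : 0 < Real.cos φ := Real.cos_pos_of_mem_Ioo ⟨by linarith, by linarith⟩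
  have hφx : Real.pi * x / (2 * n) = φ * x := by rw [hφ]; push_cast; ring
  have hexp : -3 * Real.pi ^ 2 * (Δ : ℝ) / (8 * (n : ℝ) ^ 2) = -(3 * φ ^ 2 / 2 * Δ) := by
    rw [hφ]; push_cast; field_simp; ring
  have ha0 : 0 < a := lt_of_lt_of_le (by positivity) hden
  have hcφx : 0 ≤ Real.cos (φ * x) := by
    apply Real.cos_nonneg_of_mem_Icc
    have hx' : (0 : ℝ) < x := by exact_mod_cast hx
    have hxn' : (x : ℝ) ≤ n := by exact_mod_cast hxn.le
    have h1 : φ * x ≤ φ * n := by gcongr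
    have h2 : φ * n = Real.pi / 2 := by rw [hφ]; push_cast; field_simp
    exact ⟨by have := mul_pos hφ0 hx'
              linarith, h1.trans h2.le⟩
  rw [hφx, hexp]
  set R := (8 / Real.pi) * Real.cos (φ * x) * Real.exp (-(3 * φ ^ 2 / 2 * Δ)) with hR
  have hR0 : 0 ≤ R := by positivity
  have hba : b ≤ R * a := by
    have hconst : 107 / 100 * (4 / Real.pi) * (107 / 100 * (8 / (3 * Real.pi))) * 2
        ≤ 8 / Real.pi := by
      have h31 := Real.pi_gt_d2
      rw [← sub_nonneg]
      have e : 8 / Real.pi - 107 / 100 * (4 / Real.pi) * (107 / 100 * (8 / (3 * Real.pi))) * 2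
          = 8 / Real.pi ^ 2 * (Real.pi - 107 ^ 2 / 100 ^ 2 * (8 / 3)) := by
        field_simp; ring
      rw [e]
      apply mul_nonneg (by positivity)
      norm_num at h31 ⊢
      linarith
    calc b ≤ _ := hnum
      _ = (107 / 100 * (4 / Real.pi) * (107 / 100 * (8 / (3 * Real.pi))) * 2)
          * (Real.cos φ ^ r * Real.sin (φ * x) * Real.cos (φ * x)) * Real.cos (2 * φ) ^ Δ := by
          rw [hθφ, mul_assoc 2 φ, Real.sin_two_mul]; ring
      _ ≤ (8 / Real.pi) * (Real.cos φ ^ r * Real.sin (φ * x) * Real.cos (φ * x))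
          * (Real.cos φ ^ Δ * Real.exp (-(3 * φ ^ 2 / 2 * Δ))) := by
          have := cos_two_mul_pow_le hφ0.le hφ1 Δ
          have h2 : 0 ≤ Real.cos (2 * φ) :=
            Real.cos_nonneg_of_mem_Icc ⟨by linarith, hφ1⟩
          gcongr
      _ = R * (Real.cos φ ^ (Δ + r) * Real.sin (φ * x)) := by rw [hR, pow_add]; ring
      _ ≤ R * a := by gcongr
  rw [← ofReal_measureReal, ← ofReal_measureReal, ← ha, ← hb, ← ENNReal.ofReal_inv_of_pos ha0,
    ← ENNReal.ofReal_mul (by positivity)]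
  apply ENNReal.ofReal_le_ofReal
  rw [inv_mul_le_iff₀ ha0]
  linarith

end

theorem eventually_le_of_le_liminf {a : ℕ → ℝ}
    (h : 4 / Real.pi ^ 2
      ≤ Filter.liminf (fun n : ℕ => a n / ((n : ℝ) ^ 2 * Real.log n)) atTop) :
    ∀ᶠ n : ℕ in atTop, 40 * (n : ℝ) ^ 2 ≤ a n := by
  have hpi := Real.pi_pos
  have hquarter : 1 / 4 < Filter.liminf (fun n : ℕ => a n / ((n : ℝ) ^ 2 * Real.log n)) atTop := by
    refine lt_of_lt_of_le ?_ h
    rw [div_lt_div_iff₀ (by norm_num) (by positivity)]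
    nlinarith [Real.pi_lt_d2]
  rw [Filter.liminf_eq] at hquarter
  have hne : {c | ∀ᶠ n : ℕ in atTop, c ≤ a n / ((n : ℝ) ^ 2 * Real.log n)}.Nonempty := by
    by_contra hemp
    rw [Set.not_nonempty_iff_eq_empty] at hemp
    rw [hemp, Real.sSup_empty] at hquarter
    norm_num at hquarter
  obtain ⟨c, hc, hc'⟩ := exists_lt_of_lt_csSup hne hquarter
  have hlog : ∀ᶠ n : ℕ in atTop, (160 : ℝ) ≤ Real.log n :=
    (Real.tendsto_log_atTop.comp tendsto_natCast_atTop_atTop).eventually_ge_atTop 160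
  filter_upwards [hc, hlog, eventually_ge_atTop 1] with n h1 h2 h3
  have hn : (0 : ℝ) < n := by exact_mod_cast h3
  have h4 : 1 / 4 ≤ a n / ((n : ℝ) ^ 2 * Real.log n) := hc'.le.trans h1
  rw [le_div_iff₀ (by positivity)] at h4
  have h5 : (n : ℝ) ^ 2 * 160 ≤ (n : ℝ) ^ 2 * Real.log n := by gcongr
  linarith

/-- for the simple random walk on `ℤ` conditioned on
`τ_{{0,2n}} > t` (the conditioned walk on the ring with `2n` sites), if `t`,
`Δ` and `t - Δ` all satisfy `liminf (·)/(n² ln n) ≥ 4/π²`, then for all large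
`n` and all `1 < x < n`,
`P_x[τ_n > Δ ∣ τ_{{0,2n}} > t] ≤ (1 + CΔn⁻⁴) (8/π) cos(πx/(2n)) e^{-3π²Δ/(8n²)}`. -/
theorem ring_conditioned_walk_hits_n_bound
    {Ω : Type*} [MeasurableSpace Ω] (P : ℤ → Measure Ω) (S : ℕ → Ω → ℤ)
    (hS : IsSRW P S) (t Δ : ℕ → ℕ)
    (ht : 4 / Real.pi ^ 2
      ≤ Filter.liminf (fun n : ℕ => (t n : ℝ) / ((n : ℝ) ^ 2 * Real.log n)) atTop)
    (hΔ : 4 / Real.pi ^ 2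
      ≤ Filter.liminf (fun n : ℕ => (Δ n : ℝ) / ((n : ℝ) ^ 2 * Real.log n)) atTop)
    (htΔ : 4 / Real.pi ^ 2
      ≤ Filter.liminf
          (fun n : ℕ => ((t n : ℝ) - (Δ n : ℝ)) / ((n : ℝ) ^ 2 * Real.log n)) atTop) :
    ∃ C > (0 : ℝ), ∃ n₀ : ℕ, ∀ n ≥ n₀, ∀ x : ℤ, 1 < x → x < (n : ℤ) →
      ProbabilityTheory.cond (P x)
          {ω | ∀ s ≤ t n, S s ω ∉ ({0, (2 * n : ℤ)} : Set ℤ)}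
          {ω | ∀ s ≤ Δ n, S s ω ≠ (n : ℤ)}
        ≤ ENNReal.ofReal
            ((1 + C * (Δ n : ℝ) / (n : ℝ) ^ 4) * (8 / Real.pi)
              * Real.cos (Real.pi * (x : ℝ) / (2 * n))
              * Real.exp (-3 * Real.pi ^ 2 * (Δ n : ℝ) / (8 * (n : ℝ) ^ 2))) := by
  have hlarge : ∀ᶠ n : ℕ in atTop, 1000 ≤ n ∧ 10 * n ^ 2 ≤ Δ n ∧ Δ n + 10 * (2 * n) ^ 2 ≤ t n := by
    filter_upwards [eventually_ge_atTop 1000, eventually_le_of_le_liminf hΔ,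
      eventually_le_of_le_liminf htΔ] with n h1 h2 h3
    refine ⟨h1, ?_, ?_⟩
    · have : 40 * n ^ 2 ≤ Δ n := by exact_mod_cast h2
      omega
    · have h4 : (Δ n : ℝ) + 40 * (n : ℝ) ^ 2 ≤ t n := by linarith
      have : Δ n + 40 * n ^ 2 ≤ t n := by exact_mod_cast h4
      calc _ = Δ n + 40 * n ^ 2 := by ring
        _ ≤ _ := this
  obtain ⟨n₀, hn₀⟩ := eventually_atTop.1 hlarge
  refine ⟨1, one_pos, n₀, fun n hn x hx hxn => ?_⟩
  obtain ⟨h1, h2, h3⟩ := hn₀ n hn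
  refine (hS.cond_hitting_le h1 h2 h3 (by omega) hxn).trans (ENNReal.ofReal_le_ofReal ?_)
  have hn0 : (0 : ℝ) < n := by exact_mod_cast (show 0 < n by omega)
  have hx0 : (0 : ℝ) < x := by exact_mod_cast (show 0 < x by omega)
  have hxn' : (x : ℝ) ≤ n := by exact_mod_cast hxn.le
  have hcos : 0 ≤ Real.cos (Real.pi * (x : ℝ) / (2 * n)) := by
    have hpi := Real.pi_pos
    apply Real.cos_nonneg_of_mem_Icc
    constructor
    · have : 0 ≤ Real.pi * (x : ℝ) / (2 * n) := by positivity
      linarith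
    · rw [div_le_div_iff₀ (by positivity) two_pos]
      nlinarith
  gcongr
  have hpi := Real.pi_pos
  have hfac : 0 ≤ 1 * (Δ n : ℝ) / (n : ℝ) ^ 4 := by positivity
  exact le_mul_of_one_le_left (by positivity) (by linarith)
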